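/- arXiv:2009.04307 — 10 statements merged into one kernel-verified Lean document; each statement's English description precedes it below -/
import Mathlib

section
/- For every real α > −1, every β ∈ (−1, 0), and every complex ξ with |ξ| < 1, both series below converge and ℬ(α+1, β+1) · ∑_{n=0}^∞ ξ^n / ℬ(α+1, n+β+1) = β · (1−ξ)^{−(α+2)} · ∑_{n=0}^∞ ((−1)^n/(n+β)) · binom(α+1, n) · ξ^n. -/
/-- The Beta function `ℬ(s,t) = Γ(s)Γ(t)/Γ(s+t)`. -/
noncomputable def Beta (s t : ℝ) : ℝ := Real.Gamma s * Real.Gamma t / Real.Gamma (s + t)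

/-- The generalized binomial coefficient `binom(α, n) = (∏_{k<n} (α−k)) / n!`. -/
noncomputable def genBinom (α : ℝ) (n : ℕ) : ℝ :=
  (∏ k ∈ Finset.range n, (α - k)) / (n.factorial : ℝ)

open PowerSeries

/-- The generalized binomial coefficient agrees with `Ring.choose`. -/
theorem ofReal_genBinom (r : ℝ) (n : ℕ) : (genBinom r n : ℂ) = Ring.choose (r : ℂ) n := by
  have h : (descPochhammer ℤ n).smeval (r : ℂ) = ∏ k ∈ Finset.range n, ((r : ℂ) - k) := by
    induction n with
    | zero => simp
    | succ n ih =>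
      simp [descPochhammer_succ_right, Polynomial.smeval_mul, Polynomial.smeval_natCast, ih,
        Finset.prod_range_succ]
  rw [Ring.choose_eq_smul, h, genBinom]
  push_cast
  rw [smul_eq_mul, div_eq_inv_mul]

theorem succ_mul_choose_succ (r : ℂ) (n : ℕ) :
    ((n : ℂ) + 1) * Ring.choose r (n + 1) = (r - n) * Ring.choose r n := by
  rw [Ring.choose_eq_smul, Ring.choose_eq_smul, descPochhammer_succ_right,
    Polynomial.smeval_mul, Nat.factorial_succ]
  have h1 : (n : ℂ) + 1 ≠ 0 := Nat.cast_add_one_ne_zero n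
  have h2 : (n.factorial : ℂ) ≠ 0 := Nat.cast_ne_zero.2 n.factorial_ne_zero
  simp [Polynomial.smeval_natCast]
  field_simp

/-- The formal power series `(1 - X) ^ r`. -/
noncomputable def oneSubSeries (r : ℂ) : ℂ⟦X⟧ := rescale (-1) (binomialSeries ℂ r)

theorem coeff_oneSubSeries (r : ℂ) (n : ℕ) :
    coeff n (oneSubSeries r) = (-1) ^ n * Ring.choose r n := by
  simp [oneSubSeries, coeff_rescale]

theorem oneSubSeries_add (r s : ℂ) :
    oneSubSeries (r + s) = oneSubSeries r * oneSubSeries s := by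
  simp [oneSubSeries]

theorem oneSubSeries_zero : oneSubSeries 0 = 1 := by
  simp [oneSubSeries]

theorem oneSubSeries_one : oneSubSeries 1 = 1 - X := by
  have h := binomialSeries_nat (R := ℂ) (A := ℂ) 1
  rw [Nat.cast_one, pow_one] at h
  rw [oneSubSeries, h, map_add, map_one, rescale_neg_one_X, sub_eq_add_neg]

theorem coeff_X_mul_derivative (f : ℂ⟦X⟧) (n : ℕ) :
    coeff n (X * d⁄dX ℂ f) = n * coeff n f := by
  cases n with
  | zero => simp
  | succ n => rw [coeff_succ_X_mul, coeff_derivative]; push_cast; ring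

theorem one_sub_X_mul_derivative_oneSubSeries (r : ℂ) :
    (1 - X) * d⁄dX ℂ (oneSubSeries r) = -(C r * oneSubSeries r) := by
  ext n
  rw [sub_mul, one_mul, map_sub, coeff_X_mul_derivative, map_neg, coeff_C_mul, coeff_derivative,
    coeff_oneSubSeries, coeff_oneSubSeries, pow_succ]
  linear_combination -(-1) ^ n * succ_mul_choose_succ r n

/-- The coefficients of `(1 - X) ^ (-(r + 1)) * D`, where `D` solves `X D' + b D = (1 - X) ^ r`. -/
theorem coeff_oneSubSeries_mul_recurrence {r b : ℂ} {D : ℂ⟦X⟧}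
    (hD : X * d⁄dX ℂ D + C b * D = oneSubSeries r) :
    b * coeff 0 (oneSubSeries (-(r + 1)) * D) = 1 ∧
    ∀ n : ℕ, ((n : ℂ) + 1 + b) * coeff (n + 1) (oneSubSeries (-(r + 1)) * D) =
      (n + b + r + 1) * coeff n (oneSubSeries (-(r + 1)) * D) := by
  set E := oneSubSeries (-(r + 1)) with hE
  have hinv : E * (oneSubSeries r * (1 - X)) = 1 := by
    rw [← oneSubSeries_one, ← oneSubSeries_add, hE, ← oneSubSeries_add, neg_add_cancel,
      oneSubSeries_zero]
  have hE' : (1 - X) * d⁄dX ℂ E = C (r + 1) * E := by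
    rw [one_sub_X_mul_derivative_oneSubSeries, map_neg, neg_mul, neg_neg]
  have key : X * d⁄dX ℂ (E * D) + C b * (E * D)
      = X * (X * d⁄dX ℂ (E * D)) + X * (C (b + r + 1) * (E * D)) + 1 := by
    have hC : (C (b + r + 1) : ℂ⟦X⟧) = C b + C (r + 1) := by rw [← map_add]; ring_nf
    rw [Derivation.leibniz, smul_eq_mul, smul_eq_mul, hC]
    linear_combination X * D * hE' + E * (1 - X) * hD + hinv
  constructor
  · have h := congrArg (coeff 0) key
    simpa only [map_add, coeff_zero_X_mul, coeff_C_mul, coeff_zero_one, zero_add] using h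
  · intro n
    have h := congrArg (coeff (n + 1)) key
    simp only [map_add (coeff (n + 1)), coeff_succ_X_mul _ (X * _), coeff_X_mul_derivative,
      coeff_C_mul, coeff_succ_X_mul _ (C _ * _), coeff_one, Nat.succ_ne_zero, if_false] at h
    push_cast at h
    linear_combination h

theorem Beta_pos {s t : ℝ} (hs : 0 < s) (ht : 0 < t) : 0 < Beta s t :=
  div_pos (mul_pos (Real.Gamma_pos_of_pos hs) (Real.Gamma_pos_of_pos ht))
    (Real.Gamma_pos_of_pos (add_pos hs ht))

theorem Beta_add_one_right {s t : ℝ} (hs : 0 < s) (ht : 0 < t) :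
    (s + t) * Beta s (t + 1) = t * Beta s t := by
  have hst := add_pos hs ht
  have h := (Real.Gamma_pos_of_pos hst).ne'
  rw [Beta, Beta, ← add_assoc, Real.Gamma_add_one ht.ne', Real.Gamma_add_one hst.ne']
  field_simp

theorem norm_summable_oneSubSeries (r : ℂ) {z : ℂ} (hz : ‖z‖ < 1) :
    Summable (fun n => ‖coeff n (oneSubSeries r) * z ^ n‖) := by
  have hmem : -z ∈ Metric.eball (0 : ℂ) (_root_.binomialSeries ℂ r).radius := by
    refine Metric.eball_subset_eball binomialSeries_radius_ge_one ?_
    rw [← ENNReal.ofReal_one, Metric.eball_ofReal]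
    simpa using hz
  refine ((_root_.binomialSeries ℂ r).summable_norm_apply hmem).congr fun n => ?_
  rw [binomialSeries_apply, coeff_oneSubSeries]
  simp

theorem tsum_oneSubSeries (r : ℂ) {z : ℂ} (hz : ‖z‖ < 1) :
    ∑' n, coeff n (oneSubSeries r) * z ^ n = (1 - z) ^ r := by
  have hmem : -z ∈ Metric.eball (0 : ℂ) 1 := by
    rw [← ENNReal.ofReal_one, Metric.eball_ofReal]
    simpa using hz
  have h := (Complex.one_add_cpow_hasFPowerSeriesOnBall_zero (a := r)).hasSum hmem
  rw [zero_add, ← sub_eq_add_neg] at h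
  rw [← h.tsum_eq]
  refine tsum_congr fun n => ?_
  rw [binomialSeries_apply, coeff_oneSubSeries]
  simp [neg_pow z n]
  ring

/-- Theorem 1 of the paper (non-integer case): for `α > −1`, `β ∈ (−1,0)` and `|ξ| < 1`,
both series converge and
`ℬ(α+1,β+1) ∑ ξ^n/ℬ(α+1,n+β+1) = β (1−ξ)^{−(α+2)} ∑ ((−1)^n/(n+β)) binom(α+1,n) ξ^n`. -/
theorem stmt1 (α β : ℝ) (hα : -1 < α) (hβ : β ∈ Set.Ioo (-1 : ℝ) 0)
    (ξ : ℂ) (hξ : ‖ξ‖ < 1) :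
    Summable (fun n : ℕ => ξ ^ n / (Beta (α + 1) ((n : ℝ) + β + 1) : ℂ)) ∧
    Summable (fun n : ℕ => ((-1) ^ n / ((n : ℂ) + (β : ℂ))) * (genBinom (α + 1) n : ℂ) * ξ ^ n) ∧
    (Beta (α + 1) (β + 1) : ℂ) * ∑' n : ℕ, ξ ^ n / (Beta (α + 1) ((n : ℝ) + β + 1) : ℂ)
      = (β : ℂ) * (1 - ξ) ^ (((-(α + 2)) : ℝ) : ℂ) *
        ∑' n : ℕ, ((-1) ^ n / ((n : ℂ) + (β : ℂ))) * (genBinom (α + 1) n : ℂ) * ξ ^ n := by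
  obtain ⟨hβ1, hβ0⟩ := hβ
  have hα' : 0 < α + 1 := by linarith
  have hnb (n : ℕ) : (n : ℂ) + β ≠ 0 := by
    rcases n with _ | n
    · simpa using hβ0.ne
    · have : 0 < ((n + 1 : ℕ) : ℝ) + β := by push_cast; linarith [n.cast_nonneg (α := ℝ)]
      exact_mod_cast this.ne'
  set r : ℂ := ((α + 1 : ℝ) : ℂ) with hr
  let D : ℂ⟦X⟧ := PowerSeries.mk fun n => coeff n (oneSubSeries r) / ((n : ℂ) + β)
  have hD : X * d⁄dX ℂ D + C (β : ℂ) * D = oneSubSeries r := by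
    ext n
    rw [map_add, coeff_X_mul_derivative, coeff_C_mul, ← add_mul, coeff_mk,
      mul_div_cancel₀ _ (hnb n)]
  obtain ⟨h0, hsucc⟩ := coeff_oneSubSeries_mul_recurrence hD
  have hD_term (n : ℕ) : coeff n D * ξ ^ n
      = ((-1) ^ n / ((n : ℂ) + (β : ℂ))) * (genBinom (α + 1) n : ℂ) * ξ ^ n := by
    rw [coeff_mk, coeff_oneSubSeries, ofReal_genBinom]
    ring
  have hpos (n : ℕ) : 0 < (n : ℝ) + β + 1 := by linarith [n.cast_nonneg (α := ℝ)]
  have hBpos (n : ℕ) : 0 < Beta (α + 1) ((n : ℝ) + β + 1) := Beta_pos hα' (hpos n)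
  have hBne (n : ℕ) : (Beta (α + 1) ((n : ℝ) + β + 1) : ℂ) ≠ 0 :=
    Complex.ofReal_ne_zero.2 (hBpos n).ne'
  have hcoeff (n : ℕ) : (β : ℂ) * coeff n (oneSubSeries (-(r + 1)) * D)
      * Beta (α + 1) ((n : ℝ) + β + 1) = Beta (α + 1) (β + 1) := by
    induction n with
    | zero => rw [h0]; simp
    | succ n ih =>
      have hB : (r + (n + β + 1)) * (Beta (α + 1) (((n + 1 : ℕ) : ℝ) + β + 1) : ℂ)
          = (n + β + 1) * Beta (α + 1) ((n : ℝ) + β + 1) := by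
        have h := Beta_add_one_right hα' (hpos n)
        rw [show (((n + 1 : ℕ) : ℝ) + β + 1) = (n : ℝ) + β + 1 + 1 by push_cast; ring]
        rw [hr]
        exact_mod_cast h
      have hne : (n : ℂ) + 1 + β ≠ 0 := by simpa using hnb (n + 1)
      rw [← ih]
      apply mul_left_cancel₀ hne
      linear_combination (β : ℂ) * Beta (α + 1) (((n + 1 : ℕ) : ℝ) + β + 1) * hsucc n
        + (β : ℂ) * coeff n (oneSubSeries (-(r + 1)) * D) * hB
  have hDsum : Summable fun n => ‖coeff n D * ξ ^ n‖ := by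
    have hlim : Filter.Tendsto (fun n : ℕ => ((n : ℝ) + β)⁻¹) Filter.atTop (nhds 0) :=
      (Filter.tendsto_atTop_add_const_right _ β tendsto_natCast_atTop_atTop).inv_tendsto_atTop
    obtain ⟨M, hM⟩ := hlim.norm.bddAbove_range
    refine Summable.of_nonneg_of_le (fun _ => norm_nonneg _) (fun n => ?_)
      ((norm_summable_oneSubSeries r hξ).mul_left M)
    rw [coeff_mk, div_eq_inv_mul, mul_assoc, norm_mul]
    gcongr
    refine hM ⟨n, ?_⟩
    simpa using (Complex.norm_real ((n : ℝ) + β)⁻¹).symm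
  have hEsum := norm_summable_oneSubSeries (-(r + 1)) hξ
  have hanti (n : ℕ) : ∑ kl ∈ Finset.HasAntidiagonal.antidiagonal n,
      coeff kl.1 (oneSubSeries (-(r + 1))) * ξ ^ kl.1 * (coeff kl.2 D * ξ ^ kl.2)
      = coeff n (oneSubSeries (-(r + 1)) * D) * ξ ^ n := by
    rw [coeff_mul, Finset.sum_mul]
    refine Finset.sum_congr rfl fun kl hkl => ?_
    rw [← Finset.HasAntidiagonal.mem_antidiagonal.1 hkl, pow_add]
    ring
  have hB0 : (Beta (α + 1) (β + 1) : ℂ) ≠ 0 := by simpa using hBne 0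
  have hterm (n : ℕ) : ξ ^ n / (Beta (α + 1) ((n : ℝ) + β + 1) : ℂ)
      = (β : ℂ) / Beta (α + 1) (β + 1) * (coeff n (oneSubSeries (-(r + 1)) * D) * ξ ^ n) := by
    rw [div_mul_eq_mul_div, div_eq_div_iff (hBne n) hB0, ← hcoeff n]
    ring
  have hHsum : Summable fun n => coeff n (oneSubSeries (-(r + 1)) * D) * ξ ^ n := by
    simpa only [hanti] using
      (summable_norm_sum_mul_antidiagonal_of_summable_norm hEsum hDsum).of_norm
  have hprod := tsum_mul_tsum_eq_tsum_sum_antidiagonal_of_summable_norm hEsum hDsum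
  simp only [hanti, tsum_oneSubSeries _ hξ] at hprod
  have hexp : (((-(α + 2)) : ℝ) : ℂ) = -(r + 1) := by
    rw [hr]; push_cast; ring
  simp only [hterm, ← hD_term]
  refine ⟨hHsum.mul_left _, hDsum.of_norm, ?_⟩
  rw [tsum_mul_left, ← hprod, hexp]
  field_simp
end

section
/- For every real α > −1, every β ∈ (−1, 0), and every n ∈ ℕ, the following identity holds: ∑_{k=0}^n binom(α+2, k) · (−1)^k / ℬ(α+1, n−k+β+1) = (β / ℬ(α+1, β+1)) · binom(α+1, n) · (−1)^n / (n+β). -/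
theorem genBinom_succ (a : ℝ) (j : ℕ) :
    genBinom a (j + 1) = (a - j) / (j + 1) * genBinom a j := by
  have h : ((j.factorial : ℕ) : ℝ) ≠ 0 := by positivity
  have h' : (j : ℝ) + 1 ≠ 0 := by positivity
  simp only [genBinom, Finset.prod_range_succ, Nat.factorial_succ]
  push_cast
  field_simp

theorem genBinom_succ_eq_sub_one (a : ℝ) (j : ℕ) :
    genBinom a (j + 1) = a / (j + 1) * genBinom (a - 1) j := by
  have h : ((j.factorial : ℕ) : ℝ) ≠ 0 := by positivity
  have h' : (j : ℝ) + 1 ≠ 0 := by positivity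
  have hp : ∏ k ∈ Finset.range j, (a - ((k + 1 : ℕ) : ℝ))
      = ∏ k ∈ Finset.range j, (a - 1 - k) :=
    Finset.prod_congr rfl fun k _ => by push_cast; ring
  simp only [genBinom, Finset.prod_range_succ', Nat.factorial_succ, hp]
  push_cast
  field_simp
  simp [mul_comm]

theorem inv_Beta_add_one {s t : ℝ} (hs : 0 < s) (ht : 0 < t) :
    t * (Beta s (t + 1))⁻¹ = (s + t) * (Beta s t)⁻¹ := by
  have h1 := (Real.Gamma_pos_of_pos hs).ne'
  have h2 := (Real.Gamma_pos_of_pos ht).ne'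
  have h3 := (Real.Gamma_pos_of_pos (add_pos hs ht)).ne'
  have h4 : s + t ≠ 0 := (add_pos hs ht).ne'
  have h5 := ht.ne'
  simp only [Beta, ← add_assoc, Real.Gamma_add_one h4, Real.Gamma_add_one h5]
  field_simp

/-- Closed form of the partial sums, obtained by telescoping. -/
theorem sum_genBinom_div_Beta {α β : ℝ} (hα : -1 < α) (hβ : β ∈ Set.Ioo (-1 : ℝ) 0) (j : ℕ) :
    ∀ m : ℕ, ∑ k ∈ Finset.range (j + 1),
        genBinom (α + 2) k * (-1) ^ k / Beta (α + 1) (((m + j - k : ℕ) : ℝ) + β + 1)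
      = (-1) ^ j * genBinom (α + 1) j * (Beta (α + 1) (m + β + 1))⁻¹
        * ((m + β) / (m + j + β)) := by
  obtain ⟨hβ₁, hβ₂⟩ := hβ
  induction j with
  | zero =>
    intro m
    have hm : (m : ℝ) + β ≠ 0 := by
      rcases m with _ | m
      · simpa using hβ₂.ne
      · have : (0 : ℝ) ≤ m := m.cast_nonneg
        push_cast
        linarith
    simp [genBinom, div_self hm]
  | succ j ih =>
    intro m
    have hm0 : (0 : ℝ) ≤ m := m.cast_nonneg
    have hj0 : (0 : ℝ) ≤ j := j.cast_nonneg
    have hN : (m : ℝ) + (j + 1) + β ≠ 0 := by linarith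
    have hN' : (m : ℝ) + 1 + j + β ≠ 0 := by linarith
    have hj : (j : ℝ) + 1 ≠ 0 := by positivity
    have hrec := inv_Beta_add_one (s := α + 1) (t := m + β + 1) (by linarith) (by linarith)
    have hidx : m + (j + 1) = m + 1 + j := by omega
    rw [Finset.sum_range_succ, hidx, ih (m + 1), genBinom_succ_eq_sub_one (α + 2) j,
      genBinom_succ (α + 1) j, show m + 1 + j - (j + 1) = m by omega,
      show α + 2 - 1 = α + 1 by ring]
    push_cast
    rw [show (m : ℝ) + 1 + β + 1 = m + β + 1 + 1 by ring, div_eq_mul_inv _ (Beta _ _)]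
    generalize (Beta (α + 1) (m + β + 1 + 1))⁻¹ = R' at *
    generalize (Beta (α + 1) (m + β + 1))⁻¹ = R at *
    generalize genBinom (α + 1) j = B
    rw [pow_succ]
    field_simp
    linear_combination B * (j + 1) * (m + j + 1 + β) * hrec

/-- For `α > −1`, `β ∈ (−1,0)` and `n ∈ ℕ`:
`∑_{k=0}^n binom(α+2,k) (−1)^k / ℬ(α+1, n−k+β+1) = (β/ℬ(α+1,β+1)) binom(α+1,n) (−1)^n/(n+β)`. -/
theorem stmt3 (α β : ℝ) (hα : -1 < α) (hβ : β ∈ Set.Ioo (-1 : ℝ) 0) (n : ℕ) :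
    ∑ k ∈ Finset.range (n + 1),
        genBinom (α + 2) k * (-1) ^ k / Beta (α + 1) (((n - k : ℕ) : ℝ) + β + 1)
      = (β / Beta (α + 1) (β + 1)) * genBinom (α + 1) n * (-1) ^ n / ((n : ℝ) + β) := by
  have h := sum_genBinom_div_Beta hα hβ n 0
  simp only [Nat.cast_zero, zero_add] at h
  rw [h]
  ring
end

section
/- For every real α > −1, β ∈ (−1, 0), and ξ ∈ ℂ with |ξ| < 1, the functions G_{α,β}(ξ) := ∑_{n=0}^∞ ((−1)^n/(n+β)) binom(α+1, n) ξ^n satisfy the recurrence G_{α+1,β}(ξ) = ((α+2)·G_{α,β}(ξ) + (1−ξ)^{α+2}) / (α+β+2). -/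
/-- `G_{α,β}(ξ) = ∑ ((−1)^n/(n+β)) binom(α+1,n) ξ^n`. -/
noncomputable def G (α β : ℝ) (ξ : ℂ) : ℂ :=
  ∑' n : ℕ, ((-1) ^ n / ((n : ℂ) + (β : ℂ))) * (genBinom (α + 1) n : ℂ) * ξ ^ n

theorem genBinom_eq_choose (a : ℝ) (n : ℕ) : genBinom a n = Ring.choose a n := by
  have h (n : ℕ) : (descPochhammer ℤ n).smeval a = ∏ k ∈ Finset.range n, (a - k) := by
    induction n with
    | zero => simp
    | succ n ih =>
      rw [Finset.prod_range_succ, ← ih]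
      simp [descPochhammer_succ_right, Polynomial.smeval_mul, Polynomial.smeval_natCast]
  rw [Ring.choose_eq_smul, h, genBinom, smul_eq_mul, div_eq_inv_mul]

theorem sub_mul_genBinom_add_one (a : ℝ) (n : ℕ) :
    (a + 1 - n) * genBinom (a + 1) n = (a + 1) * genBinom a n := by
  have h : (a + 1 - n) * ∏ k ∈ Finset.range n, (a + 1 - k)
      = (a + 1) * ∏ k ∈ Finset.range n, (a - k) := by
    rw [mul_comm, ← Finset.prod_range_succ (fun k : ℕ ↦ a + 1 - (k : ℝ)),
      Finset.prod_range_succ', mul_comm]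
    simp
  rw [genBinom, genBinom, ← mul_div_assoc, h, mul_div_assoc]

theorem binomialSeries_apply_neg (a : ℝ) (ξ : ℂ) (n : ℕ) :
    binomialSeries ℂ (a : ℂ) n (fun _ ↦ -ξ) = (-1) ^ n * (genBinom a n : ℂ) * ξ ^ n := by
  rw [binomialSeries_apply, genBinom_eq_choose, Complex.ofReal_choose, List.ofFn_const,
    List.prod_replicate, smul_eq_mul, neg_pow]
  ring

theorem hasSum_genBinom (a : ℝ) {ξ : ℂ} (hξ : ‖ξ‖ < 1) :
    HasSum (fun n : ℕ ↦ (-1) ^ n * (genBinom a n : ℂ) * ξ ^ n) ((1 - ξ) ^ (a : ℂ)) := by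
  have hmem : -ξ ∈ Metric.eball (0 : ℂ) 1 := by
    rw [← ENNReal.ofReal_one, Metric.eball_ofReal]
    simpa using hξ
  have h := (Complex.one_add_cpow_hasFPowerSeriesOnBall_zero (a := (a : ℂ))).hasSum hmem
  rw [zero_add, ← sub_eq_add_neg] at h
  simpa only [binomialSeries_apply_neg] using h

theorem norm_inv_natCast_add_le {β : ℝ} (hβ : β ∈ Set.Ioo (-1 : ℝ) 0) (n : ℕ) :
    ‖((n : ℂ) + (β : ℂ))⁻¹‖ ≤ (-β)⁻¹ + (1 + β)⁻¹ := by
  obtain ⟨h1, h0⟩ := hβ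
  have hp : 0 < (-β)⁻¹ := inv_pos.2 (by linarith)
  have hq : 0 < (1 + β)⁻¹ := inv_pos.2 (by linarith)
  rw [← Complex.ofReal_natCast, ← Complex.ofReal_add, norm_inv, Complex.norm_real,
    Real.norm_eq_abs]
  rcases n.eq_zero_or_pos with rfl | hn
  · rw [Nat.cast_zero, zero_add, abs_of_neg h0]
    linarith
  · have hn' : (1 : ℝ) ≤ n := by exact_mod_cast hn
    rw [abs_of_pos (by linarith)]
    have : ((n : ℝ) + β)⁻¹ ≤ (1 + β)⁻¹ := inv_anti₀ (by linarith) (by linarith)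
    linarith

theorem natCast_add_ne_zero {β : ℝ} (hβ : β ∈ Set.Ioo (-1 : ℝ) 0) (n : ℕ) :
    (n : ℂ) + (β : ℂ) ≠ 0 := by
  obtain ⟨h1, h0⟩ := hβ
  rw [← Complex.ofReal_natCast, ← Complex.ofReal_add, Complex.ofReal_ne_zero]
  rcases n.eq_zero_or_pos with rfl | hn
  · simpa using h0.ne
  · have hn' : (1 : ℝ) ≤ n := by exact_mod_cast hn
    linarith

theorem hasSum_G (α : ℝ) {β : ℝ} (hβ : β ∈ Set.Ioo (-1 : ℝ) 0) {ξ : ℂ} (hξ : ‖ξ‖ < 1) :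
    HasSum (fun n : ℕ ↦ ((-1) ^ n / ((n : ℂ) + (β : ℂ))) * (genBinom (α + 1) n : ℂ) * ξ ^ n)
      (G α β ξ) := by
  refine Summable.hasSum (.of_norm_bounded
    ((hasSum_genBinom (α + 1) hξ).summable.norm.mul_left ((-β)⁻¹ + (1 + β)⁻¹)) fun n ↦ ?_)
  rw [show ((-1) ^ n / ((n : ℂ) + (β : ℂ))) * (genBinom (α + 1) n : ℂ) * ξ ^ n
      = ((n : ℂ) + (β : ℂ))⁻¹ * ((-1) ^ n * (genBinom (α + 1) n : ℂ) * ξ ^ n) by ring, norm_mul]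
  gcongr
  exact norm_inv_natCast_add_le hβ n

/-- The recurrence `G_{α+1,β}(ξ) = ((α+2) G_{α,β}(ξ) + (1−ξ)^{α+2}) / (α+β+2)`
for `α > −1`, `β ∈ (−1,0)` and `|ξ| < 1` (principal branch power). -/
theorem stmt5 (α β : ℝ) (hα : -1 < α) (hβ : β ∈ Set.Ioo (-1 : ℝ) 0)
    (ξ : ℂ) (hξ : ‖ξ‖ < 1) :
    G (α + 1) β ξ
      = (((α : ℂ) + 2) * G α β ξ + (1 - ξ) ^ (((α + 2) : ℝ) : ℂ)) / ((α : ℂ) + (β : ℂ) + 2) := by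
  have hne : (α : ℂ) + (β : ℂ) + 2 ≠ 0 := by
    have : α + β + 2 ≠ 0 := by linarith [hβ.1]
    exact_mod_cast this
  have h := ((hasSum_G α hβ hξ).mul_left ((α : ℂ) + 2)).add (hasSum_genBinom (α + 2) hξ)
  rw [eq_div_iff hne, mul_comm]
  refine ((hasSum_G (α + 1) hβ hξ).mul_left _).unique ?_
  convert! h using 2 with n
  have hn := natCast_add_ne_zero hβ n
  have hb : ((α : ℂ) + 2 - n) * (genBinom (α + 2) n : ℂ)
      = ((α : ℂ) + 2) * (genBinom (α + 1) n : ℂ) := by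
    have := sub_mul_genBinom_add_one (α + 1) n
    rw [show α + 1 + 1 = α + 2 by ring] at this
    exact_mod_cast this
  rw [show α + 1 + 1 = α + 2 by ring]
  field_simp
  linear_combination ξ ^ n * hb
end

section
/- Let 0 < R ≤ ∞, let a : ℕ → ℂ be such that the power series ∑_{n=0}^∞ a_n z^n has radius of convergence at least R, with sum f, and let β ∈ (−1, 0). Then for every z ∈ ℂ with |z| < R, z · (T_β f)′(z) = f(z) − β · T_β f(z), where (T_β f)′ denotes the complex derivative. -/
open scoped ENNReal

/-- The linear transformation `T_β`: given the Taylor coefficients `a` of `f`,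
`T_β f (z) = ∑ (a_n/(n+β)) z^n`. -/
noncomputable def Tb (a : ℕ → ℂ) (β : ℝ) (z : ℂ) : ℂ :=
  ∑' n : ℕ, (a n / ((n : ℂ) + (β : ℂ))) * z ^ n

/-- For `-1 < β < 0`, the numbers `n + β` are bounded away from zero. -/
theorem min_le_norm_natCast_add {β : ℝ} (hβ : β ∈ Set.Ioo (-1 : ℝ) 0) (n : ℕ) :
    min (-β) (1 + β) ≤ ‖(n : ℂ) + (β : ℂ)‖ := by
  have h : ‖(n : ℂ) + (β : ℂ)‖ = |(n : ℝ) + β| := by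
    rw [← Real.norm_eq_abs, ← Complex.norm_real]
    push_cast
    rfl
  rw [h]
  rcases Nat.eq_zero_or_pos n with rfl | hn
  · simp [abs_of_neg hβ.2]
  · have hn' : (1 : ℝ) ≤ n := by exact_mod_cast hn
    exact (min_le_right _ _).trans ((by linarith : 1 + β ≤ n + β).trans (le_abs_self _))

/-- If `f(z) = ∑ a_n z^n` on `D(0,R)` and `β ∈ (−1,0)`, then
`z (T_β f)′(z) = f(z) − β T_β f(z)` for every `|z| < R`. -/
theorem stmt8 (R : ℝ≥0∞) (hR : 0 < R) (a : ℕ → ℂ) (f : ℂ → ℂ)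
    (hf : ∀ z : ℂ, ENNReal.ofReal ‖z‖ < R → HasSum (fun n : ℕ => a n * z ^ n) (f z))
    (β : ℝ) (hβ : β ∈ Set.Ioo (-1 : ℝ) 0)
    (z : ℂ) (hz : ENNReal.ofReal ‖z‖ < R) :
    z * deriv (Tb a β) z = f z - (β : ℂ) * Tb a β z := by
  have hc : 0 < min (-β) (1 + β) := lt_min (by linarith [hβ.2]) (by linarith [hβ.1])
  have hne (n : ℕ) : (n : ℂ) + (β : ℂ) ≠ 0 :=
    norm_pos_iff.1 (hc.trans_le (min_le_norm_natCast_add hβ n))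
  obtain ⟨s, hzs, hsR⟩ := ENNReal.lt_iff_exists_nnreal_btwn.1 hz
  have hzs' : ‖z‖ < s := by
    rwa [← ENNReal.ofReal_coe_nnreal, ENNReal.ofReal_lt_ofReal_iff_of_nonneg (norm_nonneg z)] at hzs
  have hs := (hf ((s : ℝ) : ℂ) (by simpa using hsR)).summable.norm
  have hbound (n : ℕ) (w : ℂ) (hw : w ∈ Metric.ball (0 : ℂ) s) :
      ‖(a n / ((n : ℂ) + (β : ℂ))) * w ^ n‖ ≤
        (min (-β) (1 + β))⁻¹ * ‖a n * ((s : ℝ) : ℂ) ^ n‖ := by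
    have hw' : ‖w‖ ≤ s := (mem_ball_zero_iff.1 hw).le
    have hinv := inv_anti₀ hc (min_le_norm_natCast_add hβ n)
    calc ‖(a n / ((n : ℂ) + (β : ℂ))) * w ^ n‖
        = ‖(n : ℂ) + (β : ℂ)‖⁻¹ * (‖a n‖ * ‖w‖ ^ n) := by
          rw [norm_mul, norm_div, norm_pow]
          ring
      _ ≤ (min (-β) (1 + β))⁻¹ * (‖a n‖ * (s : ℝ) ^ n) := by gcongr
      _ = _ := by simp
  have hu := hs.mul_left (min (-β) (1 + β))⁻¹
  have hz' : z ∈ Metric.ball (0 : ℂ) s := mem_ball_zero_iff.2 hzs'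
  have hT : HasSum (fun n : ℕ => (a n / ((n : ℂ) + (β : ℂ))) * z ^ n) (Tb a β z) :=
    (hu.of_norm_bounded fun n => hbound n z hz').hasSum
  have hD := (Complex.hasSum_deriv_of_summable_norm hu
    (fun n => ((differentiable_id.pow n).const_mul _).differentiableOn)
    Metric.isOpen_ball hbound hz').mul_left z
  refine hD.unique ?_
  convert! (hf z hz).sub (hT.mul_left (β : ℂ)) using 2 with n
  have hderiv : deriv (fun w : ℂ => (a n / ((n : ℂ) + (β : ℂ))) * w ^ n) z =
      (a n / ((n : ℂ) + (β : ℂ))) * (n * z ^ (n - 1)) :=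
    ((hasDerivAt_pow n z).const_mul _).deriv
  have hpow : z * (n * z ^ (n - 1)) = n * z ^ n := by
    cases n with
    | zero => simp
    | succ k => rw [Nat.add_sub_cancel]; ring
  rw [hderiv, mul_left_comm, hpow]
  have := hne n
  field_simp
  ring
end

section
/- Let p ≥ 2 and let f(z) = ∑_{n=0}^p a_n z^n be a complex polynomial with a_0 ≠ 0 and a_p ≠ 0. Suppose 𝒳 : (−1, 0) → ℂ satisfies T_β f(𝒳(β)) = ∑_{n=0}^p (a_n/(n+β)) 𝒳(β)^n = 0 for every β ∈ (−1, 0). Then |𝒳(β)| → +∞ as β → 0⁻, and β · 𝒳(β)^p → −p·a_0/a_p as β → 0⁻; equivalently 𝒳(β)^p is asymptotically equivalent to −p·a_0/(a_p·β) as β → 0⁻. -/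
open Filter

/-- A nonnegative function whose values, under a map monotone on `[0, ∞)`, tend to
`+∞` itself tends to `+∞`. -/
theorem tendsto_atTop_of_monotoneOn_comp {α : Type*} {l : Filter α} {u : α → ℝ} {G : ℝ → ℝ}
    (hu : ∀ x, 0 ≤ u x) (hG : MonotoneOn G (Set.Ici 0))
    (h : Tendsto (fun x => G (u x)) l atTop) : Tendsto u l atTop := by
  refine tendsto_atTop.2 fun R => ?_
  filter_upwards [h.eventually_gt_atTop (G (max R 0))] with x hx
  by_contra! hlt
  exact absurd (hG (hu x) (le_max_right R 0) (hlt.le.trans (le_max_left R 0))) (not_le.2 hx)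

/-- As `u` tends to infinity and `β` tends to `0`, the nonconstant part of `T_β f (u β)` divided by
`u β ^ p` tends to the leading coefficient `a_p / p` of its limit. -/
theorem tendsto_sum_div_pow {p : ℕ} (hp : 1 ≤ p) (a : ℕ → ℂ) {l : Filter ℝ} (hl : l ≤ nhds 0)
    {u : ℝ → ℂ} (hu : Tendsto (fun β => (u β)⁻¹) l (nhds 0)) :
    Tendsto (fun β : ℝ => ∑ n ∈ Finset.range p,
      a (n + 1) / (((n + 1 : ℕ) : ℂ) + β) * (u β)⁻¹ ^ (p - (n + 1))) l (nhds (a p / p)) := by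
  have hβ : Tendsto (fun β : ℝ => (β : ℂ)) l (nhds 0) := by
    simpa using (Complex.continuous_ofReal.tendsto 0).mono_left hl
  have key : Tendsto (fun β : ℝ => ∑ n ∈ Finset.range p,
      a (n + 1) / (((n + 1 : ℕ) : ℂ) + β) * (u β)⁻¹ ^ (p - (n + 1))) l
      (nhds (∑ n ∈ Finset.range p,
        a (n + 1) / (((n + 1 : ℕ) : ℂ) + 0) * 0 ^ (p - (n + 1)))) := by
    refine tendsto_finsetSum _ fun n _ => ?_
    refine (tendsto_const_nhds.div (tendsto_const_nhds.add hβ) ?_).mul (hu.pow _)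
    rw [add_zero]
    exact Nat.cast_ne_zero.2 n.succ_ne_zero
  convert key using 2
  obtain ⟨q, rfl⟩ := Nat.exists_eq_add_of_le' hp
  rw [Finset.sum_range_succ, Finset.sum_eq_zero]
  · simp
  · intro n hn
    have hn' := Finset.mem_range.1 hn
    rw [zero_pow (by omega), mul_zero]

/-- Theorem 3 part 1: for a polynomial `f(z) = ∑_{n=0}^p a_n z^n` of degree `p ≥ 2` with
`a_0 ≠ 0`, any curve `𝒳` of zeros of `T_β f` on `(−1,0)` satisfies `|𝒳(β)| → ∞` as
`β → 0⁻` and `β·𝒳(β)^p → −p a_0/a_p` as `β → 0⁻`. -/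
theorem stmt12 (p : ℕ) (hp : 2 ≤ p) (a : ℕ → ℂ) (ha0 : a 0 ≠ 0) (hap : a p ≠ 0)
    (X : ℝ → ℂ)
    (hX : ∀ β ∈ Set.Ioo (-1 : ℝ) 0,
      ∑ n ∈ Finset.range (p + 1), (a n / ((n : ℂ) + (β : ℂ))) * (X β) ^ n = 0) :
    Tendsto (fun β : ℝ => ‖X β‖) (nhdsWithin 0 (Set.Iio (0 : ℝ))) atTop ∧
    Tendsto (fun β : ℝ => (β : ℂ) * (X β) ^ p) (nhdsWithin 0 (Set.Iio (0 : ℝ)))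
      (nhds (-(p : ℂ) * a 0 / a p)) := by
  have hev : ∀ᶠ β : ℝ in nhdsWithin 0 (Set.Iio (0 : ℝ)), β ∈ Set.Ioo (-1 / 2 : ℝ) 0 :=
    Ioo_mem_nhdsLT (by norm_num)
  have hsum : ∀ β ∈ Set.Ioo (-1 / 2 : ℝ) 0,
      ∑ n ∈ Finset.range p, a (n + 1) / (((n + 1 : ℕ) : ℂ) + β) * X β ^ (n + 1)
        = -(a 0 / β) := by
    intro β hβ
    have h := hX β ⟨by linarith [hβ.1], hβ.2⟩
    rw [Finset.sum_range_succ'] at h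
    simpa using eq_neg_of_add_eq_zero_left h
  have hnorm : Tendsto (fun β : ℝ => ‖X β‖) (nhdsWithin 0 (Set.Iio (0 : ℝ))) atTop := by
    refine tendsto_atTop_of_monotoneOn_comp
      (G := fun r => ∑ n ∈ Finset.range p, 2 * ‖a (n + 1)‖ * r ^ (n + 1))
      (fun _ => norm_nonneg _) ?_ ?_
    · intro r hr s _ hrs
      have hr0 : 0 ≤ r := hr
      dsimp only
      gcongr
    · have hinv : Tendsto (fun β : ℝ => ‖a 0‖ * (-β)⁻¹)
          (nhdsWithin 0 (Set.Iio (0 : ℝ))) atTop := by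
        refine Tendsto.const_mul_atTop (norm_pos_iff.2 ha0) ?_
        simpa only [inv_neg, Function.comp_def] using tendsto_neg_atBot_atTop.comp
          (tendsto_inv_nhdsLT_zero (𝕜 := ℝ))
      refine tendsto_atTop_mono' _ ?_ hinv
      filter_upwards [hev] with β hβ
      have heq : ‖a 0‖ * (-β)⁻¹ = ‖-(a 0 / (β : ℂ))‖ := by
        rw [norm_neg, norm_div, Complex.norm_real, Real.norm_eq_abs, abs_of_neg hβ.2,
          div_eq_mul_inv]
      rw [heq, ← hsum β hβ]
      refine (norm_sum_le _ _).trans (Finset.sum_le_sum fun n _ => ?_)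
      rw [norm_mul, norm_pow, norm_div]
      gcongr
      have hden : (1 / 2 : ℝ) ≤ ‖((n + 1 : ℕ) : ℂ) + (β : ℂ)‖ := by
        have hcast : ((n + 1 : ℕ) : ℂ) + (β : ℂ) = (((n : ℝ) + 1 + β : ℝ) : ℂ) := by
          push_cast; ring
        rw [hcast, Complex.norm_real, Real.norm_eq_abs]
        refine le_trans ?_ (le_abs_self _)
        linarith [hβ.1, (Nat.cast_nonneg n : (0 : ℝ) ≤ n)]
      rw [div_le_iff₀ (by linarith)]
      nlinarith [norm_nonneg (a (n + 1))]
  refine ⟨hnorm, ?_⟩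
  have hXinv : Tendsto (fun β => (X β)⁻¹) (nhdsWithin 0 (Set.Iio (0 : ℝ))) (nhds 0) :=
    tendsto_inv₀_cobounded.comp (tendsto_norm_atTop_iff_cobounded.1 hnorm)
  have hlim := tendsto_sum_div_pow (by omega : 1 ≤ p) a nhdsWithin_le_nhds hXinv
  have hp0 : (p : ℂ) ≠ 0 := Nat.cast_ne_zero.2 (by omega)
  have hlim' := (tendsto_const_nhds (x := -a 0)).div hlim (div_ne_zero hap hp0)
  have hval : -(p : ℂ) * a 0 / a p = -a 0 / (a p / p) := by
    field_simp
  rw [hval]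
  refine hlim'.congr' ?_
  filter_upwards [hev, hnorm.eventually_gt_atTop 0] with β hβ hpos
  have hX0 : X β ≠ 0 := norm_pos_iff.1 hpos
  have hβ0 : (β : ℂ) ≠ 0 := Complex.ofReal_ne_zero.2 hβ.2.ne
  have hquot : ∑ n ∈ Finset.range p,
      a (n + 1) / (((n + 1 : ℕ) : ℂ) + β) * (X β)⁻¹ ^ (p - (n + 1))
        = -(a 0 / β) / X β ^ p := by
    rw [← hsum β hβ, Finset.sum_div]
    refine Finset.sum_congr rfl fun n hn => ?_
    have hn' : n + 1 ≤ p := Finset.mem_range.1 hn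
    rw [mul_div_assoc, inv_pow, pow_sub₀ _ hX0 hn', mul_inv, inv_inv,
      div_eq_mul_inv (X β ^ (n + 1)), mul_comm (X β ^ p)⁻¹]
  simp only [Pi.div_apply]
  rw [hquot]
  field_simp
end

section
/- Let p ≥ 2 and let f(z) = ∑_{n=0}^p a_n z^n be a complex polynomial with a_0 ≠ 0, a_1 ≠ 0, and a_p ≠ 0. Suppose 𝒳 : (−1, 0) → ℂ satisfies T_β f(𝒳(β)) = ∑_{n=0}^p (a_n/(n+β)) 𝒳(β)^n = 0 for every β ∈ (−1, 0), and that 𝒳(β) → 0 as β → (−1)⁺. Then 𝒳(β)/(1+β) → a_0/a_1 as β → (−1)⁺, i.e., 𝒳(β) is asymptotically equivalent to (a_0/a_1)(1+β) as β → (−1)⁺. -/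
open Filter

/-- Theorem 3, equation (3.7): for a polynomial `f(z) = ∑_{n=0}^p a_n z^n` of degree
`p ≥ 2` with `a_0, a_1, a_p ≠ 0`, if `𝒳` is a curve of zeros of `T_β f` on `(−1,0)` with
`𝒳(β) → 0` as `β → (−1)⁺`, then `𝒳(β)/(1+β) → a_0/a_1` as `β → (−1)⁺`. -/
theorem stmt13 (p : ℕ) (hp : 2 ≤ p) (a : ℕ → ℂ)
    (ha0 : a 0 ≠ 0) (ha1 : a 1 ≠ 0) (hap : a p ≠ 0)
    (X : ℝ → ℂ)
    (hX : ∀ β ∈ Set.Ioo (-1 : ℝ) 0,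
      ∑ n ∈ Finset.range (p + 1), (a n / ((n : ℂ) + (β : ℂ))) * (X β) ^ n = 0)
    (hlim : Tendsto X (nhdsWithin (-1) (Set.Ioi (-1 : ℝ))) (nhds 0)) :
    Tendsto (fun β : ℝ => X β / (1 + (β : ℂ)))
      (nhdsWithin (-1) (Set.Ioi (-1 : ℝ))) (nhds (a 0 / a 1)) := by
  obtain ⟨m, rfl⟩ : ∃ m, p = m + 1 := ⟨p - 1, by omega⟩
  have hβ : Tendsto (fun β : ℝ => (β : ℂ)) (nhdsWithin (-1) (Set.Ioi (-1 : ℝ))) (nhds (-1)) := by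
    have h : Tendsto (fun β : ℝ => (β : ℂ)) (nhds (-1)) (nhds ((-1 : ℝ) : ℂ)) :=
      Complex.continuous_ofReal.tendsto (-1)
    simpa using h.mono_left nhdsWithin_le_nhds
  have htail : Tendsto (fun β : ℝ => ∑ n ∈ Finset.range m,
      (a (n + 1 + 1) / (((n + 1 + 1 : ℕ) : ℂ) + (β : ℂ))) * (X β) ^ (n + 1 + 1))
      (nhdsWithin (-1) (Set.Ioi (-1 : ℝ))) (nhds 0) := by
    rw [← Finset.sum_const_zero (s := Finset.range m)]
    refine tendsto_finsetSum _ fun n _ => ?_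
    have hne : (((n + 1 + 1 : ℕ) : ℂ) + (-1)) ≠ 0 := by
      have : (((n + 1 + 1 : ℕ) : ℂ) + (-1)) = ((n + 1 : ℕ) : ℂ) := by push_cast; ring
      rw [this]
      exact Nat.cast_ne_zero.mpr n.succ_ne_zero
    simpa using ((tendsto_const_nhds (x := a (n + 1 + 1))).div
      (hβ.const_add ((n + 1 + 1 : ℕ) : ℂ)) hne).mul (hlim.pow (n + 1 + 1))
  have hhead : Tendsto (fun β : ℝ => a 0 / (β : ℂ))
      (nhdsWithin (-1) (Set.Ioi (-1 : ℝ))) (nhds (a 0 / (-1))) :=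
    tendsto_const_nhds.div hβ (by simp)
  have hsum := ((htail.add hhead).neg).div_const (a 1)
  have hval : -(0 + a 0 / (-1)) / a 1 = a 0 / a 1 := by simp [div_neg]
  rw [hval] at hsum
  refine hsum.congr' ?_
  filter_upwards [Ioo_mem_nhdsGT (show (-1 : ℝ) < 0 by norm_num)] with β hmem
  have h := hX β hmem
  rw [Finset.sum_range_succ', Finset.sum_range_succ'] at h
  simp only [zero_add, Nat.cast_zero, Nat.cast_one, pow_zero, pow_one, mul_one] at h
  rw [div_eq_iff ha1]
  linear_combination -h
end

section
/- Let p ≥ 2 and let f(z) = ∑_{n=0}^p a_n z^n be a complex polynomial with a_0 ≠ 0, a_1 ≠ 0, and a_p ≠ 0. Suppose 𝒳 : (−1, 0) → ℂ satisfies T_β f(𝒳(β)) = ∑_{n=0}^p (a_n/(n+β)) 𝒳(β)^n = 0 for every β ∈ (−1, 0), and that |𝒳(β)| → +∞ as β → (−1)⁺. Then (1+β) · 𝒳(β)^{p−1} → −(p−1)·a_1/a_p as β → (−1)⁺. -/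
open Filter

/-- Theorem 3, equation (3.6): for a polynomial `f(z) = ∑_{n=0}^p a_n z^n` of degree
`p ≥ 2` with `a_0, a_1, a_p ≠ 0`, if `𝒳` is a curve of zeros of `T_β f` on `(−1,0)` with
`|𝒳(β)| → ∞` as `β → (−1)⁺`, then `(1+β)·𝒳(β)^{p−1} → −(p−1) a_1/a_p` as `β → (−1)⁺`. -/
theorem stmt14 (p : ℕ) (hp : 2 ≤ p) (a : ℕ → ℂ)
    (ha0 : a 0 ≠ 0) (ha1 : a 1 ≠ 0) (hap : a p ≠ 0)
    (X : ℝ → ℂ)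
    (hX : ∀ β ∈ Set.Ioo (-1 : ℝ) 0,
      ∑ n ∈ Finset.range (p + 1), (a n / ((n : ℂ) + (β : ℂ))) * (X β) ^ n = 0)
    (hlim : Tendsto (fun β : ℝ => ‖X β‖) (nhdsWithin (-1) (Set.Ioi (-1 : ℝ))) atTop) :
    Tendsto (fun β : ℝ => (1 + (β : ℂ)) * (X β) ^ (p - 1))
      (nhdsWithin (-1) (Set.Ioi (-1 : ℝ))) (nhds (-((p : ℂ) - 1) * a 1 / a p)) := by
  obtain ⟨q, rfl⟩ : ∃ q, p = q + 2 := ⟨p - 2, by omega⟩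
  set l := nhdsWithin (-1 : ℝ) (Set.Ioi (-1 : ℝ)) with hl
  have hβ : Tendsto (fun β : ℝ => (β : ℂ)) l (nhds (-1)) := by
    have h : Tendsto (fun β : ℝ => (β : ℂ)) (nhds (-1)) (nhds ((-1 : ℝ) : ℂ)) :=
      Complex.continuous_ofReal.tendsto _
    simpa using h.mono_left nhdsWithin_le_nhds
  have hY : Tendsto (fun β : ℝ => (X β)⁻¹) l (nhds 0) :=
    tendsto_inv₀_cobounded.comp (tendsto_norm_atTop_iff_cobounded.mp hlim)
  set D : ℝ → ℂ := fun β => ∑ k ∈ Finset.range (q + 1),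
    a (k + 2) / ((k : ℂ) + 2 + β) * (X β)⁻¹ ^ (q - k) with hD
  have hq : ((q : ℂ) + 1) ≠ 0 := by exact_mod_cast Nat.succ_ne_zero q
  have hDlim : Tendsto D l (nhds (a (q + 2) / ((q : ℂ) + 1))) := by
    have h : Tendsto D l (nhds (∑ k ∈ Finset.range (q + 1),
        a (k + 2) / ((k : ℂ) + 2 + (-1)) * 0 ^ (q - k))) := by
      refine tendsto_finsetSum _ fun k _ => ?_
      refine (tendsto_const_nhds.div (tendsto_const_nhds.add hβ) ?_).mul (hY.pow _)
      have : ((k : ℂ) + 1) ≠ 0 := by exact_mod_cast Nat.succ_ne_zero k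
      convert this using 1
      ring
    convert h using 2
    rw [Finset.sum_range_succ, Finset.sum_eq_zero]
    · simp only [Nat.sub_self, pow_zero, mul_one, zero_add]
      congr 1
      ring
    · intro k hk
      rw [zero_pow (by have := Finset.mem_range.mp hk; omega), mul_zero]
  have hD0 : a (q + 2) / ((q : ℂ) + 1) ≠ 0 := div_ne_zero hap hq
  have hN : Tendsto (fun β : ℝ => -(a 1 + (1 + (β : ℂ)) * (a 0 / β) * (X β)⁻¹) / D β) l
      (nhds (-(a 1 + (1 + -1) * (a 0 / -1) * 0) / (a (q + 2) / ((q : ℂ) + 1)))) :=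
    ((tendsto_const_nhds.add (((tendsto_const_nhds.add hβ).mul
      (tendsto_const_nhds.div hβ (by norm_num))).mul hY)).neg).div hDlim hD0
  have hval : -(a 1 + (1 + -1) * (a 0 / -1) * 0) / (a (q + 2) / ((q : ℂ) + 1)) =
      -(((q + 2 : ℕ) : ℂ) - 1) * a 1 / a (q + 2) := by
    push_cast
    field_simp
    ring
  rw [← hval]
  refine hN.congr' ?_
  have hIoo : ∀ᶠ β in l, β ∈ Set.Ioo (-1 : ℝ) 0 := Ioo_mem_nhdsGT (by norm_num)
  filter_upwards [hIoo, hDlim.eventually_ne hD0, hlim.eventually_gt_atTop 0] with β hb hDβ hXβ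
  have hX0 : X β ≠ 0 := norm_pos_iff.mp hXβ
  have h1 : (1 + (β : ℂ)) ≠ 0 := by
    exact_mod_cast (by linarith [hb.1] : (0 : ℝ) < 1 + β).ne'
  have hsum : ∑ k ∈ Finset.range (q + 1),
      a (k + 1 + 1) / (((k + 1 + 1 : ℕ) : ℂ) + β) * X β ^ (k + 1 + 1) = D β * X β ^ (q + 2) := by
    rw [hD, Finset.sum_mul]
    refine Finset.sum_congr rfl fun k hk => ?_
    have hk' : q + 2 = (q - k) + (k + 2) := by have := Finset.mem_range.mp hk; omega
    have hpow : (X β)⁻¹ ^ (q - k) * X β ^ (q + 2) = X β ^ (k + 2) := by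
      rw [hk', pow_add _ (q - k), ← mul_assoc, ← mul_pow, inv_mul_cancel₀ hX0, one_pow, one_mul]
    rw [mul_assoc, hpow]
    push_cast
    ring_nf
  have h := hX β hb
  rw [Finset.sum_range_succ', Finset.sum_range_succ', hsum] at h
  simp only [Nat.cast_zero, zero_add, pow_zero, mul_one, Nat.cast_one, pow_one] at h
  rw [div_eq_iff hDβ, show q + 2 - 1 = q + 1 by omega]
  have key : (1 + (β : ℂ)) * (X β)⁻¹ *
      (D β * X β ^ (q + 2) + a 1 / (1 + (β : ℂ)) * X β + a 0 / β) = 0 := by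
    rw [h, mul_zero]
  have e : (1 + (β : ℂ)) * (X β)⁻¹ *
      (D β * X β ^ (q + 2) + a 1 / (1 + (β : ℂ)) * X β + a 0 / β) =
      (1 + (β : ℂ)) * X β ^ (q + 1) * D β + (a 1 + (1 + (β : ℂ)) * (a 0 / β) * (X β)⁻¹) := by
    have e1 : (X β)⁻¹ * X β = 1 := inv_mul_cancel₀ hX0
    have e2 : (1 + (β : ℂ)) * (a 1 / (1 + (β : ℂ))) = a 1 := mul_div_cancel₀ _ h1
    linear_combination ((1 + (β : ℂ)) * D β * X β ^ (q + 1) +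
      (1 + (β : ℂ)) * (a 1 / (1 + (β : ℂ)))) * e1 + e2
  linear_combination e - key
end

section
/- For every α ∈ ℕ and every real number x < 0, there exists β ∈ (−1, 0) such that ∑_{n=0}^{α+1} ((−1)^n/(n+β)) · C(α+1, n) · x^n = 0, where C(α+1, n) is the ordinary binomial coefficient. -/
/-- For every `α ∈ ℕ` and every real `x < 0`, there is `β ∈ (−1,0)` such that
`∑_{n=0}^{α+1} ((−1)^n/(n+β)) C(α+1,n) x^n = 0`. -/
theorem stmt15 (α : ℕ) (x : ℝ) (hx : x < 0) :
    ∃ β ∈ Set.Ioo (-1 : ℝ) 0,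
      ∑ n ∈ Finset.range (α + 2),
        ((-1) ^ n / ((n : ℝ) + β)) * (Nat.choose (α + 1) n : ℝ) * x ^ n = 0 := by
  -- The terms with `n ≥ 2` are continuous in `β` on `[-1, 0]`; the other two have simple poles
  -- at the endpoints, which the factor `β * (1 + β)` removes.
  set R : ℝ → ℝ := fun β => ∑ n ∈ Finset.range α,
    ((-1) ^ (n + 1 + 1) / (((n + 1 + 1 : ℕ) : ℝ) + β)) *
      (Nat.choose (α + 1) (n + 1 + 1) : ℝ) * x ^ (n + 1 + 1)
  have hRcont : ContinuousOn R (Set.Icc (-1) 0) := by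
    refine continuousOn_finsetSum _ fun n _ => ?_
    refine ((continuousOn_const.div (by fun_prop) fun β hβ => ?_).mul
      continuousOn_const).mul continuousOn_const
    have hn : (0 : ℝ) ≤ n := n.cast_nonneg
    push_cast
    linarith [hβ.1]
  have hcont : ContinuousOn (fun β => 1 + β - (α + 1) * x * β + β * (1 + β) * R β)
      (Set.Icc (-1) 0) :=
    ContinuousOn.add (by fun_prop) (ContinuousOn.mul (by fun_prop) hRcont)
  have hpos : (0 : ℝ) < (α + 1) * -x := mul_pos (by positivity) (by linarith)
  obtain ⟨β, hβ, hzero⟩ := intermediate_value_Ioo (by norm_num) hcont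
    (show (0 : ℝ) ∈ Set.Ioo _ _ from ⟨by norm_num; linarith, by norm_num⟩)
  refine ⟨β, hβ, ?_⟩
  have h0 : β ≠ 0 := hβ.2.ne
  have h1 : 1 + β ≠ 0 := by linarith [hβ.1]
  rw [Finset.sum_range_succ', Finset.sum_range_succ']
  change R β + _ + _ = 0
  dsimp only at hzero
  generalize R β = r at hzero ⊢
  norm_num
  field_simp
  linarith
end

section
/- For every α ∈ ℕ, the zero set in ℂ of the polynomial ξ ↦ (1+ξ)^{α+2} + (1−ξ)^{α+2} is exactly {−i·tan((2k+1)π/(2(α+2))) : k ∈ ℕ, 0 ≤ k ≤ α+1, 2k+1 ≠ α+2}. -/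
open Complex in
/-- The Cayley transform `ξ ↦ (1 - ξ) / (1 + ξ)` takes the value `exp (2θi)` exactly where
`ξ cos θ = -i sin θ`. -/
theorem one_sub_eq_exp_sq_mul_one_add_iff (θ ξ : ℂ) :
    1 - ξ = exp (θ * I) ^ 2 * (1 + ξ) ↔ ξ * cos θ = -I * sin θ := by
  have hE : exp (θ * I) = cos θ + sin θ * I := exp_mul_I θ
  have hinv : (cos θ - sin θ * I) * exp (θ * I) = 1 := by
    rw [hE]
    linear_combination sin_sq_add_cos_sq θ - sin θ ^ 2 * I_sq
  constructor
  · intro h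
    linear_combination (-1 / 2) * (cos θ - sin θ * I) * h
      - (1 / 2) * exp (θ * I) * (1 + ξ) * hinv - (1 / 2) * (1 + ξ) * hE
  · intro h
    linear_combination (-2) * exp (θ * I) * h - (1 - ξ) * hinv - exp (θ * I) * (1 + ξ) * hE

/-- `cos ((2k+1)π/(2n))` vanishes for `k < n` only if `2k+1 = n`. -/
theorem cos_odd_mul_pi_div_ne_zero {n k : ℕ} (hk : k < n) (hkn : 2 * k + 1 ≠ n) :
    Real.cos ((2 * k + 1) * Real.pi / (2 * n)) ≠ 0 := by
  intro h
  obtain ⟨m, hm⟩ := Real.cos_eq_zero_iff.mp h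
  have hn : (n : ℝ) ≠ 0 := by exact_mod_cast (by omega : n ≠ 0)
  have hR : (2 * k + 1 : ℝ) = (2 * m + 1) * n := by
    field_simp at hm
    linarith
  have hZ : (2 * k + 1 : ℤ) = (2 * m + 1) * n := by exact_mod_cast hR
  have hm0 : m = 0 := by
    have h1 : -1 < m := by
      by_contra! hlt
      nlinarith
    have h2 : m < 1 := by
      by_contra! hlt
      nlinarith
    omega
  subst hm0
  omega

open Complex in
/-- The `n`-th roots of `-1` are the numbers `exp ((2k+1)πi/n)`, `k < n`. -/
theorem pow_eq_neg_one_iff_exists_exp {n : ℕ} (hn : n ≠ 0) (w : ℂ) :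
    w ^ n = -1 ↔
      ∃ k < n, w = exp (((2 * k + 1) * Real.pi / (2 * n) : ℝ) * I) ^ 2 := by
  have hnC : (n : ℂ) ≠ 0 := by exact_mod_cast hn
  have key (k : ℕ) : exp (((2 * k + 1) * Real.pi / (2 * n) : ℝ) * I) ^ 2
      = exp (2 * Real.pi * I / n) ^ k * exp (Real.pi * I / n) := by
    rw [← exp_nat_mul, ← exp_nat_mul, ← exp_add]
    congr 1
    push_cast
    field_simp
  have hroot : exp (Real.pi * I / n) ^ n = -1 := by
    rw [← exp_nat_mul, mul_div_cancel₀ _ hnC, exp_pi_mul_I]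
  have hprim := isPrimitiveRoot_exp n hn
  simp only [key]
  constructor
  · intro h
    have : NeZero n := ⟨hn⟩
    obtain ⟨k, hk, hkw⟩ := hprim.eq_pow_of_pow_eq_one (ξ := w / exp (Real.pi * I / n))
      (by rw [div_pow, h, hroot, div_self (by norm_num)])
    exact ⟨k, hk, by rw [hkw, div_mul_cancel₀ _ (exp_ne_zero _)]⟩
  · rintro ⟨k, -, rfl⟩
    rw [mul_pow, hroot, ← pow_mul, mul_comm k, pow_mul, hprim.pow_eq_one, one_pow, one_mul]

/-- The zero set of `ξ ↦ (1+ξ)^{α+2} + (1−ξ)^{α+2}` is exactly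
`{−i·tan((2k+1)π/(2(α+2))) : 0 ≤ k ≤ α+1, 2k+1 ≠ α+2}`. -/
theorem stmt17 (α : ℕ) :
    {ξ : ℂ | (1 + ξ) ^ (α + 2) + (1 - ξ) ^ (α + 2) = 0} =
      {z : ℂ | ∃ k : ℕ, k ≤ α + 1 ∧ 2 * k + 1 ≠ α + 2 ∧
        z = -Complex.I * (Real.tan ((2 * k + 1) * Real.pi / (2 * (α + 2))) : ℝ)} := by
  have hcast : ((α + 2 : ℕ) : ℝ) = α + 2 := by push_cast; ring
  have hroots := pow_eq_neg_one_iff_exists_exp (n := α + 2) (by omega)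
  simp only [hcast] at hroots
  ext ξ
  simp only [Set.mem_ofPred_eq]
  constructor
  · intro h
    have hξ : 1 + ξ ≠ 0 := by
      intro h0
      rw [h0, zero_pow (by omega), zero_add] at h
      have h1 := pow_eq_zero_iff (by omega) |>.mp h
      have : (2 : ℂ) = 0 := by linear_combination h0 + h1
      norm_num at this
    obtain ⟨k, hk, hw⟩ := (hroots ((1 - ξ) / (1 + ξ))).mp (by
      rw [div_pow, div_eq_iff (pow_ne_zero _ hξ)]
      linear_combination h)
    rw [div_eq_iff hξ, one_sub_eq_exp_sq_mul_one_add_iff] at hw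
    have hkn : 2 * k + 1 ≠ α + 2 := by
      intro hkn
      have hR : (2 * k + 1 : ℝ) = α + 2 := by exact_mod_cast hkn
      have hpos : (α + 2 : ℝ) ≠ 0 := by positivity
      have hθ : (2 * k + 1) * Real.pi / (2 * (α + 2)) = Real.pi / 2 := by
        rw [hR]
        field_simp
      rw [hθ, ← Complex.ofReal_cos, ← Complex.ofReal_sin, Real.cos_pi_div_two,
        Real.sin_pi_div_two] at hw
      simp at hw
    refine ⟨k, by omega, hkn, ?_⟩
    have hcos := cos_odd_mul_pi_div_ne_zero hk hkn
    rw [hcast, ← Complex.ofReal_ne_zero] at hcos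
    rw [← Complex.ofReal_cos, ← Complex.ofReal_sin] at hw
    rw [Real.tan_eq_sin_div_cos, Complex.ofReal_div, ← mul_div_assoc, eq_div_iff hcos, hw]
  · rintro ⟨k, hk, hkn, hξ⟩
    have hcos := cos_odd_mul_pi_div_ne_zero (n := α + 2) (by omega) hkn
    rw [hcast, ← Complex.ofReal_ne_zero] at hcos
    rw [Real.tan_eq_sin_div_cos, Complex.ofReal_div, ← mul_div_assoc, eq_div_iff hcos,
      Complex.ofReal_cos, Complex.ofReal_sin, ← one_sub_eq_exp_sq_mul_one_add_iff] at hξ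
    rw [hξ, mul_pow, (hroots _).mpr ⟨k, by omega, rfl⟩]
    ring
end

section
/- Let τ ∈ ℕ, r ∈ {0, 1, 2, 3}, and α = 4τ + r. Then the number of zeros of the polynomial ξ ↦ (1+ξ)^{α+2} + (1−ξ)^{α+2} lying in the open unit disk 𝔻 (all of which are simple, so the count equals the cardinality of the zero set in 𝔻) is 2τ if r = 0 and 2τ+2 if r ∈ {1, 2, 3}; and the number of zeros of the polynomial ξ ↦ (1+ξ)^{α+2} − (1−ξ)^{α+2} lying in 𝔻 is 2τ+1 if r ∈ {0, 1, 2} and 2τ+3 if r = 3. -/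
open Complex in
/-- A point of the imaginary axis `i tan x` satisfies `(1+ξ)^N = e^{iπs} (1-ξ)^N` exactly when
`2Nx ≡ πs` modulo `2π`. -/
lemma one_add_tan_mul_I_pow_eq_iff (N : ℕ) (s : ℤ) {x : ℝ} (hx : Real.cos x ≠ 0) :
    (1 + (Real.tan x : ℂ) * I) ^ N = exp (s * (Real.pi * I)) * (1 - (Real.tan x : ℂ) * I) ^ N ↔
      ∃ k : ℤ, 2 * N * x = (2 * k + s) * Real.pi := by
  have hc : Complex.cos x ≠ 0 := by exact_mod_cast hx
  have h₁ : (1 + (Real.tan x : ℂ) * I) = exp (x * I) / Complex.cos x := by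
    rw [exp_mul_I, ofReal_tan, Complex.tan]
    field_simp
  have h₂ : (1 - (Real.tan x : ℂ) * I) = exp (-(x * I)) / Complex.cos x := by
    rw [← neg_mul, exp_mul_I, ofReal_tan, Complex.tan, Complex.cos_neg, Complex.sin_neg]
    field_simp
    ring
  rw [h₁, h₂, div_pow, div_pow, ← mul_div_assoc, div_left_inj' (pow_ne_zero _ hc),
    ← exp_nat_mul, ← exp_nat_mul, ← exp_add, exp_eq_exp_iff_exists_int]
  refine exists_congr fun k => ?_
  rw [← ofReal_inj]
  push_cast
  constructor
  · intro h
    apply mul_right_cancel₀ I_ne_zero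
    linear_combination h
  · intro h
    linear_combination I * h

/-- The zeros of `(1+ξ)^N - e^{iπs} (1-ξ)^N` in the open unit disk are counted by the integers
congruent to `s` modulo `2` of absolute value less than `N / 2`. -/
lemma ncard_zeros_unit_disk {N : ℕ} (hN : 0 < N) (s : ℤ) :
    {ξ : ℂ | ‖ξ‖ < 1 ∧
      (1 + ξ) ^ N = Complex.exp (s * (Real.pi * Complex.I)) * (1 - ξ) ^ N}.ncard =
      {k : ℤ | 2 * |2 * k + s| < N}.ncard := by
  have hN' : (0 : ℝ) < N := by exact_mod_cast hN
  have hπ := Real.pi_pos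
  have habs (k : ℤ) : 2 * |2 * k + s| < N ↔
      |(2 * k + s) * Real.pi / (2 * N)| < Real.pi / 4 := by
    have : |(2 * k + s) * Real.pi / (2 * N)| = |2 * (k : ℝ) + s| * Real.pi / (2 * N) := by
      rw [abs_div, abs_mul, abs_of_pos hπ, abs_of_pos (by positivity : (0 : ℝ) < 2 * N)]
    rw [this, div_lt_div_iff₀ (by positivity) (by positivity), ← @Int.cast_lt ℝ]
    push_cast
    constructor <;> intro h <;> nlinarith
  have htan {x : ℝ} (hx : |x| < Real.pi / 4) : |Real.tan x| < 1 := by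
    obtain ⟨h₁, h₂⟩ := abs_lt.1 hx
    rw [abs_lt, ← Real.tan_pi_div_four, ← Real.tan_neg]
    constructor <;> apply Real.tan_lt_tan_of_lt_of_lt_pi_div_two <;> linarith
  have hinj : Set.InjOn
      (fun k : ℤ => (Real.tan ((2 * k + s) * Real.pi / (2 * N)) : ℂ) * Complex.I)
      {k : ℤ | 2 * |2 * k + s| < N} := by
    intro a ha b hb h
    have ha' := abs_lt.1 ((habs a).1 ha)
    have hb' := abs_lt.1 ((habs b).1 hb)
    have h' := Complex.ofReal_injective (mul_right_cancel₀ Complex.I_ne_zero h)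
    have h'' := Real.injOn_tan ⟨by linarith, by linarith⟩ ⟨by linarith, by linarith⟩ h'
    have h₃ : (a : ℝ) = b := by
      field_simp at h''
      linarith
    exact_mod_cast h₃
  rw [← hinj.ncard_image]
  congr 1
  ext ξ
  simp only [Set.mem_ofPred_eq, Set.mem_image]
  constructor
  · rintro ⟨hξ, h⟩
    have hnorm : ‖1 + ξ‖ = ‖1 - ξ‖ := by
      have h' := congrArg norm h
      rw [norm_mul, norm_pow, norm_pow, ← mul_assoc] at h'
      have he : ‖Complex.exp ((s * Real.pi : ℝ) * Complex.I)‖ = 1 :=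
        Complex.norm_exp_ofReal_mul_I _
      push_cast at he
      rw [he, one_mul] at h'
      exact (pow_left_inj₀ (norm_nonneg _) (norm_nonneg _) hN.ne').1 h'
    have hre : ξ.re = 0 := by
      have h' := congrArg (· ^ 2) hnorm
      simp only [← Complex.normSq_eq_norm_sq, Complex.normSq_apply, Complex.add_re,
        Complex.sub_re, Complex.add_im, Complex.sub_im, Complex.one_re, Complex.one_im] at h'
      linarith
    have hξI : ξ = (Real.tan (Real.arctan ξ.im) : ℂ) * Complex.I := by
      rw [Real.tan_arctan]
      apply Complex.ext <;> simp [hre]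
    have him : |ξ.im| < 1 := (Complex.abs_im_le_norm ξ).trans_lt hξ
    rw [hξI, one_add_tan_mul_I_pow_eq_iff N s (Real.cos_arctan_pos _).ne'] at h
    obtain ⟨k, hk⟩ := h
    have hk' : (2 * k + s) * Real.pi / (2 * N) = Real.arctan ξ.im := by
      rw [← hk]
      field_simp
    refine ⟨k, ?_, by rw [hk', ← hξI]⟩
    rw [habs, hk', abs_lt, ← Real.arctan_one, ← Real.arctan_neg]
    exact ⟨Real.arctan_strictMono (abs_lt.1 him).1, Real.arctan_strictMono (abs_lt.1 him).2⟩
  · rintro ⟨k, hk, rfl⟩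
    rw [habs] at hk
    have hk' := abs_lt.1 hk
    refine ⟨by simpa only [norm_mul, Complex.norm_I, mul_one, Complex.norm_real,
      Real.norm_eq_abs] using htan hk, ?_⟩
    rw [one_add_tan_mul_I_pow_eq_iff N s
      (Real.cos_pos_of_mem_Ioo ⟨by linarith, by linarith⟩).ne']
    exact ⟨k, by field_simp⟩

/-- The zero counts `ε_{α,0}` and `Θ_{α,0}` in the open unit disk of the polynomials
`(1+ξ)^{α+2} + (1−ξ)^{α+2}` and `(1+ξ)^{α+2} − (1−ξ)^{α+2}`, for `α = 4τ + r`,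
`r ∈ {0,1,2,3}`: since all zeros are simple, the counts are the cardinalities of the
zero sets in `𝔻`. -/
theorem stmt19 (τ r : ℕ) (hr : r ≤ 3) (α : ℕ) (hα : α = 4 * τ + r) :
    {ξ : ℂ | ‖ξ‖ < 1 ∧ (1 + ξ) ^ (α + 2) + (1 - ξ) ^ (α + 2) = 0}.ncard
      = (if r = 0 then 2 * τ else 2 * τ + 2) ∧
    {ξ : ℂ | ‖ξ‖ < 1 ∧ (1 + ξ) ^ (α + 2) - (1 - ξ) ^ (α + 2) = 0}.ncard
      = (if r = 3 then 2 * τ + 3 else 2 * τ + 1) := by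
  subst hα
  constructor
  · have h := ncard_zeros_unit_disk (N := 4 * τ + r + 2) (by omega) 1
    simp only [Int.cast_one, one_mul, Complex.exp_pi_mul_I, neg_one_mul,
      eq_neg_iff_add_eq_zero] at h
    rw [h]
    let t : ℤ := if r = 0 then τ else τ + 1
    have hk : {k : ℤ | 2 * |2 * k + 1| < (4 * τ + r + 2 : ℕ)} = Finset.Ico (-t) t := by
      ext k
      simp only [abs_eq_max_neg, Set.mem_ofPred_eq, Finset.coe_Ico, Set.mem_Ico, t]
      split_ifs <;> omega
    rw [hk, Set.ncard_coe_finset, Int.card_Ico]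
    simp only [t]
    split_ifs <;> omega
  · have h := ncard_zeros_unit_disk (N := 4 * τ + r + 2) (by omega) 0
    simp only [Int.cast_zero, zero_mul, Complex.exp_zero, one_mul, add_zero,
      ← sub_eq_zero (a := (1 + _ : ℂ) ^ _)] at h
    rw [h]
    let t : ℤ := if r = 3 then τ + 1 else τ
    have hk : {k : ℤ | 2 * |2 * k| < (4 * τ + r + 2 : ℕ)} = Finset.Icc (-t) t := by
      ext k
      simp only [abs_eq_max_neg, Set.mem_ofPred_eq, Finset.coe_Icc, Set.mem_Icc, t]
      split_ifs <;> omega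
    rw [hk, Set.ncard_coe_finset, Int.card_Icc]
    simp only [t]
    split_ifs <;> omega
end
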